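/- arXiv:0910.4465 — 2 statements merged into one kernel-verified Lean document; each statement's English description precedes it below -/
import Mathlib

section
/- Let k be a field of characteristic zero, D a derivation of k[x,y], and p, q ∈ k[x,y] algebraically independent polynomials with D(p) = D(q) = 0. Then D = 0. -/
open MvPolynomial

lemma deriv_aeval_aux {k A : Type*} [Field k] [CommRing A] [Algebra k A]
    (D : Derivation k A A) (S : Subalgebra k A) (hS : ∀ s ∈ S, D s = 0) (a : A)
    (P : Polynomial S) :
    D (Polynomial.aeval a P) = Polynomial.aeval a (Polynomial.derivative P) * D a := by
  induction P using Polynomial.induction_on' with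
  | add f g hf hg => simp [hf, hg, add_mul]
  | monomial n c =>
    have hc : D (algebraMap S A c) = 0 := hS _ c.2
    rw [Polynomial.derivative_monomial, Polynomial.aeval_monomial, Polynomial.aeval_monomial,
      Derivation.leibniz, hc, Derivation.leibniz_pow]
    simp only [smul_eq_mul, nsmul_eq_mul, map_mul, map_natCast]
    ring

lemma deriv_algebraic_aux {k A : Type*} [Field k] [CharZero k] [CommRing A] [IsDomain A]
    [Algebra k A]
    (D : Derivation k A A) (S : Subalgebra k A) (hS : ∀ s ∈ S, D s = 0) (a : A)
    (n : ℕ) : ∀ P : Polynomial S, P.natDegree = n → P ≠ 0 → Polynomial.aeval a P = 0 →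
      D a = 0 := by
  have : CharZero A := charZero_of_injective_algebraMap (algebraMap k A).injective
  induction n using Nat.strong_induction_on with
  | _ n ih =>
    intro P hn hP h0
    by_contra hDa
    have h := deriv_aeval_aux D S hS a P
    rw [h0, map_zero, eq_comm, mul_eq_zero] at h
    have h1 := h.resolve_right hDa
    by_cases hd : P.natDegree = 0
    · rw [Polynomial.eq_C_of_natDegree_eq_zero hd] at h0 hP
      rw [Polynomial.aeval_C] at h0
      apply hP
      have : P.coeff 0 = 0 := Subtype.ext h0
      rw [this, map_zero]
    · refine hDa (ih _ (hn ▸ Polynomial.natDegree_derivative_lt hd) _ rfl ?_ h1)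
      intro hz
      exact hd (Polynomial.natDegree_eq_zero_of_derivative_eq_zero hz)

/-- A derivation of `k[x,y]` annihilating two algebraically independent
polynomials is zero. -/
theorem derivation_eq_zero_of_annihilates_alg_indep
    {k : Type*} [Field k] [CharZero k]
    (D : Derivation k (MvPolynomial (Fin 2) k) (MvPolynomial (Fin 2) k))
    (p q : MvPolynomial (Fin 2) k)
    (hpq : AlgebraicIndependent k ![p, q])
    (hp : D p = 0) (hq : D q = 0) :
    D = 0 := by
  have hb : IsTranscendenceBasis k ![p, q] :=
    hpq.isTranscendenceBasis_of_lift_trdeg_le_of_finite (by simp)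
  have halg := hb.isAlgebraic
  have hS : ∀ s ∈ Algebra.adjoin k (Set.range ![p, q]), D s = 0 := by
    intro s hs
    refine Derivation.eqOn_adjoin (D1 := D) (D2 := 0) ?_ hs
    rintro _ ⟨i, rfl⟩
    fin_cases i <;> simp [hp, hq]
  ext1 i
  obtain ⟨P, hP, h0⟩ := halg.isAlgebraic (X i)
  simpa using deriv_algebraic_aux D _ hS (X i) _ P rfl hP h0
end

section
/- Let k be a field of characteristic zero and let u, v ∈ k(x,y) be rational functions. If the Jacobian determinant det J(u,v) = (∂u/∂x)(∂v/∂y) - (∂u/∂y)(∂v/∂x) equals zero, then u and v are algebraically dependent over k. -/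
open MvPolynomial

/-- A derivation killing a transcendence basis is zero in characteristic zero. -/
theorem derivation_eq_zero_of_transcendenceBasis {k K ι : Type*} [Field k] [CharZero k] [Field K]
    [Algebra k K] {x : ι → K} (hx : IsTranscendenceBasis k x) (D : Derivation k K K)
    (h : ∀ i, D (x i) = 0) (a : K) : D a = 0 := by
  have halg := hx.isAlgebraic_field
  set F := IntermediateField.adjoin k (Set.range x) with hF
  have hD : ∀ f ∈ F, D f = 0 := by
    intro f hf
    induction hf using IntermediateField.adjoin_induction with
    | mem y hy => obtain ⟨i, rfl⟩ := hy; exact h i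
    | algebraMap y => simp
    | add y z _ _ hy hz => simp [hy, hz]
    | inv y _ hy => simp [Derivation.leibniz_inv, hy]
    | mul y z _ _ hy hz => simp [hy, hz]
  have hunr : Algebra.FormallyUnramified F K := Algebra.FormallyUnramified.of_isSeparable F K
  have hsub : Subsingleton (Ω[K⁄F]) := inferInstance
  let L : K →ₗ[F] K :=
    { toFun := D
      map_add' := D.map_add
      map_smul' := fun f y => by
        have := hD f f.2
        simp [IntermediateField.smul_def, this] }
  let D' : Derivation F K K := Derivation.mk' L (fun y z => D.leibniz y z)
  have h1 : D' a = 0 := by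
    rw [← D'.liftKaehlerDifferential_comp_D, Subsingleton.elim (KaehlerDifferential.D F K a) 0,
      map_zero]
  exact h1



/-- If the Jacobian determinant of two rational functions `u, v ∈ k(x,y)`
vanishes, then `u` and `v` are algebraically dependent over `k`.
Here `Dx, Dy` are the extensions of `∂/∂x, ∂/∂y` to `k(x,y)`. -/
theorem algebraically_dependent_of_jacobian_eq_zero
    {k : Type*} [Field k] [CharZero k]
    (Dx Dy : Derivation k (FractionRing (MvPolynomial (Fin 2) k))
              (FractionRing (MvPolynomial (Fin 2) k)))
    (hDx : ∀ r : MvPolynomial (Fin 2) k,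
      Dx (algebraMap (MvPolynomial (Fin 2) k) (FractionRing (MvPolynomial (Fin 2) k)) r) =
        algebraMap (MvPolynomial (Fin 2) k) (FractionRing (MvPolynomial (Fin 2) k)) (pderiv 0 r))
    (hDy : ∀ r : MvPolynomial (Fin 2) k,
      Dy (algebraMap (MvPolynomial (Fin 2) k) (FractionRing (MvPolynomial (Fin 2) k)) r) =
        algebraMap (MvPolynomial (Fin 2) k) (FractionRing (MvPolynomial (Fin 2) k)) (pderiv 1 r))
    (u v : FractionRing (MvPolynomial (Fin 2) k))
    (hjac : Dx u * Dy v - Dy u * Dx v = 0) :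
    ¬ AlgebraicIndependent k ![u, v] := by
  intro hind
  have htr : Algebra.trdeg k (FractionRing (MvPolynomial (Fin 2) k)) = 2 := by
    have halg : Algebra.IsAlgebraic (MvPolynomial (Fin 2) k) (FractionRing (MvPolynomial (Fin 2) k)) :=
      IsLocalization.isAlgebraic _ (nonZeroDivisors (MvPolynomial (Fin 2) k))
    have := _root_.trdeg_add_eq k (MvPolynomial (Fin 2) k) (A := FractionRing (MvPolynomial (Fin 2) k))
    rw [← this, trdeg_eq_zero_iff.2 halg, MvPolynomial.trdeg_of_isDomain]
    simp
  have hb : IsTranscendenceBasis k ![u, v] := by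
    apply hind.isTranscendenceBasis_of_lift_trdeg_le_of_finite
    rw [htr]; simp
  have key : ∀ D : Derivation k (FractionRing (MvPolynomial (Fin 2) k)) (FractionRing (MvPolynomial (Fin 2) k)), D u = 0 → D v = 0 → ∀ a, D a = 0 := fun D hu hv =>
    derivation_eq_zero_of_transcendenceBasis hb D (by
      intro i; fin_cases i <;> simp [hu, hv])
  have hxx := hDx (X 0)
  have hxy := hDx (X 1)
  have hyx := hDy (X 0)
  have hyy := hDy (X 1)
  simp only [pderiv_X_self, map_one] at hxx hyy
  rw [pderiv_X_of_ne (by decide), map_zero] at hxy hyx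
  have e1 : ∀ a, (Dy u • Dx - Dx u • Dy) a = 0 := by
    apply key
    · simp only [Derivation.sub_apply, Derivation.smul_apply, smul_eq_mul]; ring
    · simp only [Derivation.sub_apply, Derivation.smul_apply, smul_eq_mul]
      linear_combination -hjac
  have e2 : ∀ a, (Dy v • Dx - Dx v • Dy) a = 0 := by
    apply key
    · simp only [Derivation.sub_apply, Derivation.smul_apply, smul_eq_mul]
      linear_combination hjac
    · simp only [Derivation.sub_apply, Derivation.smul_apply, smul_eq_mul]; ring
  have a1 := e1 (algebraMap (MvPolynomial (Fin 2) k) (FractionRing (MvPolynomial (Fin 2) k)) (X 1))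
  have a2 := e2 (algebraMap (MvPolynomial (Fin 2) k) (FractionRing (MvPolynomial (Fin 2) k)) (X 1))
  simp only [Derivation.sub_apply, Derivation.smul_apply, smul_eq_mul, hxy, hyy, mul_zero,
    mul_one, zero_sub, neg_eq_zero] at a1 a2
  have := key Dx a1 a2 (algebraMap (MvPolynomial (Fin 2) k) (FractionRing (MvPolynomial (Fin 2) k)) (X 0))
  rw [hxx] at this
  exact one_ne_zero this
end
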